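/- Let w : ℝ³ → ℂ be infinitely differentiable with (closed) support contained in the open ball B_R. Then for every x with ‖x‖ > R, the modified Helmholtz potential of (Δ − κ²)w vanishes: ∫_{B_R} (e^{−κ‖x−y‖}/(4π‖x−y‖)) ((Δw)(y) − κ² w(y)) dy = 0. -/

import Mathlib

open MeasureTheory Real

noncomputable section

abbrev E3 := EuclideanSpace ℝ (Fin 3)

/-- The open ball of radius `R` centered at the origin. -/
def ball3 (R : ℝ) : Set E3 := {x : E3 | ‖x‖ < R}

/-- The Laplacian: the sum of the second partial derivatives along coordinate directions. -/
def Lap (w : E3 → ℂ) (x : E3) : ℂ :=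
  ∑ i : Fin 3,
    fderiv ℝ (fun z => fderiv ℝ w z (EuclideanSpace.single i (1 : ℝ))) x
      (EuclideanSpace.single i (1 : ℝ))

def rho (x y : E3) : ℝ := ‖x - y‖

def gF (κ r : ℝ) : ℝ := Real.exp (-(κ * r)) / (4 * π * r)

def psiF (κ r : ℝ) : ℝ := -(Real.exp (-(κ * r)) * (κ * r + 1)) / (4 * π * r ^ 3)

lemma gF_deriv (κ r : ℝ) (hr : 0 < r) : HasDerivAt (gF κ) (psiF κ r * r) r := by
  have h1 : HasDerivAt (fun r : ℝ => Real.exp (-(κ * r))) (Real.exp (-(κ * r)) * (-(κ * 1))) r :=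
    (((hasDerivAt_id r).const_mul κ).neg).exp
  have h2 : HasDerivAt (fun r : ℝ => 4 * π * r) (4 * π * 1) r := (hasDerivAt_id r).const_mul _
  have hp := Real.pi_pos
  have h4 : HasDerivAt (gF κ) _ r := h1.div h2 (by positivity)
  refine h4.congr_deriv ?_
  unfold psiF
  field_simp
  ring

lemma psiF_deriv (κ r : ℝ) (hr : 0 < r) :
    HasDerivAt (psiF κ) ((κ ^ 2 * gF κ r - 3 * psiF κ r) / r) r := by
  have h1 : HasDerivAt (fun r : ℝ => Real.exp (-(κ * r))) (Real.exp (-(κ * r)) * (-(κ * 1))) r :=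
    (((hasDerivAt_id r).const_mul κ).neg).exp
  have h3 : HasDerivAt (fun r : ℝ => κ * r + 1) (κ * 1) r :=
    ((hasDerivAt_id r).const_mul κ).add_const _
  have h2 : HasDerivAt (fun r : ℝ => 4 * π * r ^ 3) (4 * π * (3 * r ^ 2)) r := by
    simpa using (hasDerivAt_pow 3 r).const_mul (4 * π)
  have hp := Real.pi_pos
  have h4 : HasDerivAt (psiF κ) _ r := (h1.mul h3).neg.div h2 (by positivity)
  refine h4.congr_deriv ?_
  unfold psiF gF
  simp only [Pi.mul_apply, Pi.neg_apply]
  field_simp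
  ring

lemma rho_pos {x y : E3} (h : y ≠ x) : 0 < rho x y :=
  norm_pos_iff.2 (sub_ne_zero.2 h.symm)

lemma rho_fderiv {x y : E3} (h : y ≠ x) :
    HasFDerivAt (rho x) ((rho x y)⁻¹ • innerSL ℝ (y - x)) y := by
  have hp := rho_pos h
  have h1 : HasFDerivAt (fun z : E3 => z - x) (ContinuousLinearMap.id ℝ E3) y :=
    (hasFDerivAt_id y).sub_const x
  have h2 := h1.norm_sq.sqrt (by
    have : 0 < ‖y - x‖ := norm_pos_iff.2 (sub_ne_zero.2 h)
    positivity)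
  have e : rho x = fun z => √(‖z - x‖ ^ 2) := by
    funext z
    rw [Real.sqrt_sq (norm_nonneg _), rho, norm_sub_rev]
  have e2 : √(‖y - x‖ ^ 2) = rho x y := by rw [e]
  rw [e2, ← e] at h2
  refine h2.congr_fderiv ?_
  ext v
  simp [-map_sub, -PiLp.inner_apply]
  field_simp

lemma rho_contDiffAt {x y : E3} (h : y ≠ x) : ContDiffAt ℝ 1 (rho x) y := by
  unfold rho
  exact (contDiffAt_const.sub contDiffAt_id).norm ℝ (sub_ne_zero.2 h.symm)

def FF (κ : ℝ) (x : E3) (w : E3 → ℂ) (i : Fin 3) (y : E3) : ℂ :=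
  gF κ (rho x y) • fderiv ℝ w y (EuclideanSpace.single i (1 : ℝ))
    - (psiF κ (rho x y) * (y i - x i)) • w y

lemma FF_zero (κ : ℝ) (x : E3) (w : E3 → ℂ) (i : Fin 3) (y : E3) (h : y ∉ tsupport w) :
    FF κ x w i =ᶠ[nhds y] fun _ => 0 := by
  have h0 : w =ᶠ[nhds y] fun _ => (0 : ℂ) := notMem_tsupport_iff_eventuallyEq.1 h
  filter_upwards [h0.eventuallyEq_nhds] with z hz
  unfold FF
  rw [hz.fderiv_eq, hz.eq_of_nhds]
  simp

lemma dw_contDiff (w : E3 → ℂ) (hw : ContDiff ℝ (⊤ : ℕ∞) w) (v : E3) :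
    ContDiff ℝ 1 (fun z => fderiv ℝ w z v) :=
  (hw.fderiv_right (m := 1) (by norm_cast)).clm_apply contDiff_const

lemma FF_contDiff (κ : ℝ) (x : E3) (w : E3 → ℂ) (i : Fin 3) (hw : ContDiff ℝ (⊤ : ℕ∞) w)
    (hx : x ∉ tsupport w) : ContDiff ℝ 1 (FF κ x w i) := by
  rw [contDiff_iff_contDiffAt]
  intro y
  by_cases h : y = x
  · subst h
    exact contDiffAt_const.congr_of_eventuallyEq (FF_zero κ y w i y hx)
  have hp := rho_pos h
  have hr := rho_contDiffAt h
  have hpi := Real.pi_pos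
  have hw1 : ContDiffAt ℝ 1 w y := (hw.of_le (by exact_mod_cast le_top)).contDiffAt
  have hco : ContDiffAt ℝ 1 (fun z : E3 => z i - x i) y := by fun_prop
  have he : ContDiffAt ℝ 1 (fun z => Real.exp (-(κ * rho x z))) y :=
    (contDiffAt_const.mul hr).neg.exp
  unfold FF gF psiF
  refine ((he.div (contDiffAt_const.mul hr) (by positivity)).smul
    (dw_contDiff w hw _).contDiffAt).sub (ContDiffAt.smul (ContDiffAt.mul ?_ hco) hw1)
  exact ((he.mul ((contDiffAt_const.mul hr).add contDiffAt_const)).neg).div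
    (contDiffAt_const.mul (hr.pow 3)) (by positivity)

lemma FF_fderiv (κ : ℝ) (x : E3) (w : E3 → ℂ) (i : Fin 3) (hw : ContDiff ℝ (⊤ : ℕ∞) w)
    {y : E3} (h : y ≠ x) :
    fderiv ℝ (FF κ x w i) y (EuclideanSpace.single i (1 : ℝ)) =
      gF κ (rho x y) • fderiv ℝ (fun z => fderiv ℝ w z (EuclideanSpace.single i (1 : ℝ))) y
        (EuclideanSpace.single i (1 : ℝ))
      - ((κ ^ 2 * gF κ (rho x y) - 3 * psiF κ (rho x y)) / (rho x y) ^ 2 * (y i - x i) ^ 2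
          + psiF κ (rho x y)) • w y := by
  have hp := rho_pos h
  have hr := rho_fderiv h
  have hg := (gF_deriv κ _ hp).comp_hasFDerivAt y hr
  have hps := (psiF_deriv κ _ hp).comp_hasFDerivAt y hr
  have hdw := ((dw_contDiff w hw (EuclideanSpace.single i (1 : ℝ))).differentiable
    (by norm_num) y).hasFDerivAt
  have hw1 := ((hw.differentiable (by simp)) y).hasFDerivAt
  have hco : HasFDerivAt (fun z : E3 => z i - x i) (EuclideanSpace.proj i : E3 →L[ℝ] ℝ) y :=
    ((EuclideanSpace.proj i : E3 →L[ℝ] ℝ).hasFDerivAt).sub_const _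
  have hF : HasFDerivAt (FF κ x w i) _ y := (hg.smul hdw).sub ((hps.mul hco).smul hw1)
  rw [hF.fderiv]
  have hin : inner ℝ (y - x) (EuclideanSpace.single i (1 : ℝ)) = y i - x i := by
    simp [EuclideanSpace.inner_single_right]
  simp [hin, -map_sub]
  have hpc : (rho x y : ℂ) ≠ 0 := by exact_mod_cast hp.ne'
  field_simp
  ring

lemma sum_FF (κ : ℝ) (x : E3) (w : E3 → ℂ) (hw : ContDiff ℝ (⊤ : ℕ∞) w)
    (hx : x ∉ tsupport w) (y : E3) :
    ∑ i, fderiv ℝ (FF κ x w i) y (EuclideanSpace.single i (1 : ℝ)) =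
      (gF κ (rho x y) : ℂ) * (Lap w y - (κ : ℂ) ^ 2 * w y) := by
  by_cases h : y = x
  · subst h
    simp [(FF_zero κ y w _ y hx).fderiv_eq, gF, rho]
  have hp := rho_pos h
  have hs : (rho x y) ^ 2 = (y 0 - x 0) ^ 2 + (y 1 - x 1) ^ 2 + (y 2 - x 2) ^ 2 := by
    rw [rho, EuclideanSpace.norm_sq_eq]
    simp [Fin.sum_univ_three]
    ring
  simp_rw [FF_fderiv κ x w _ hw h]
  rw [Finset.sum_sub_distrib, ← Finset.smul_sum, ← Finset.sum_smul]
  have : ∑ i : Fin 3, ((κ ^ 2 * gF κ (rho x y) - 3 * psiF κ (rho x y)) / (rho x y) ^ 2 *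
      (y i - x i) ^ 2 + psiF κ (rho x y)) = κ ^ 2 * gF κ (rho x y) := by
    rw [Fin.sum_univ_three]
    have h2 : (κ ^ 2 * gF κ (rho x y) - 3 * psiF κ (rho x y)) / (rho x y) ^ 2 * (rho x y) ^ 2
      = (κ ^ 2 * gF κ (rho x y) - 3 * psiF κ (rho x y)) := by field_simp
    have h3 := congrArg
      (fun t => (κ ^ 2 * gF κ (rho x y) - 3 * psiF κ (rho x y)) / (rho x y) ^ 2 * t) hs
    simp only at h3
    linarith
  rw [this]
  simp only [Lap, Complex.real_smul]
  push_cast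
  ring

lemma FF_integral (f : E3 → ℂ) (hf : ContDiff ℝ 1 f) (hc : HasCompactSupport f) (v : E3) :
    Integrable (fun y => fderiv ℝ f y v) ∧ ∫ y, fderiv ℝ f y v = 0 := by
  have h1 : Integrable (fun y => fderiv ℝ f y v) :=
    ((hf.continuous_fderiv (by norm_num)).clm_apply continuous_const).integrable_of_hasCompactSupport
      (hc.fderiv_apply ℝ v)
  refine ⟨h1, ?_⟩
  have := integral_mul_fderiv_eq_neg_fderiv_mul_of_integrable (μ := volume) (v := v)
    (f := fun _ : E3 => (1 : ℂ)) (g := f) (by simp) (by simpa using h1)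
    (by simpa using hf.continuous.integrable_of_hasCompactSupport hc)
    (fun y _ => by fun_prop) (fun y _ => hf.differentiable (by norm_num) y)
  simpa using this

theorem modified_helmholtz_potential_of_modified_operator_vanishes
    (κ R : ℝ) (hκ : 0 < κ) (hR : 0 < R)
    (w : E3 → ℂ) (hw : ContDiff ℝ (⊤ : ℕ∞) w) (hsupp : tsupport w ⊆ ball3 R) :
    ∀ x : E3, R < ‖x‖ →
      (∫ y in ball3 R,
        (((Real.exp (-(κ * ‖x - y‖)) / (4 * π * ‖x - y‖) : ℝ)) : ℂ) *
          (Lap w y - (κ : ℂ) ^ 2 * w y)) = 0 := by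
  intro x hx
  have hxs : x ∉ tsupport w := fun h => by
    have : ‖x‖ < R := hsupp h
    linarith
  have hcomp : IsCompact (tsupport w) :=
    (isCompact_closedBall (0 : E3) R).of_isClosed_subset (isClosed_tsupport w) (fun y hy => by
      have : ‖y‖ < R := hsupp hy
      simpa using this.le)
  have hFc : ∀ i, HasCompactSupport (FF κ x w i) := fun i =>
    HasCompactSupport.intro hcomp (fun y hy => (FF_zero κ x w i y hy).eq_of_nhds)
  have hI := fun i => FF_integral _ (FF_contDiff κ x w i hw hxs) (hFc i)
    (EuclideanSpace.single i (1 : ℝ))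
  have key := sum_FF κ x w hw hxs
  have e : (fun y => (((Real.exp (-(κ * ‖x - y‖)) / (4 * π * ‖x - y‖) : ℝ)) : ℂ) *
          (Lap w y - (κ : ℂ) ^ 2 * w y)) =
      fun y => ∑ i, fderiv ℝ (FF κ x w i) y (EuclideanSpace.single i (1 : ℝ)) := by
    funext y
    rw [key y]
    rfl
  rw [e, setIntegral_eq_integral_of_forall_compl_eq_zero, integral_finsetSum]
  · exact Finset.sum_eq_zero (fun i _ => (hI i).2)
  · exact fun i _ => (hI i).1
  · intro y hy
    have hy' : y ∉ tsupport w := fun h => hy (hsupp h)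
    exact Finset.sum_eq_zero (fun i _ => by simp [(FF_zero κ x w i y hy').fderiv_eq])
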